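/- Let (K,𝒦) be a measurable space and let (T_k)_{k∈K} be a family of firmly quasinonexpansive operators on H such that the map (k,x) ↦ T_k x is (𝒦 ⊗ ℬ_H)-to-ℬ_H measurable and, for every k ∈ K, Id − T_k is demiclosed at 0. Let k be a K-valued random variable, suppose Z = {z ∈ H : z ∈ Fix T_k P-a.s.} is nonempty, and let x₀ ∈ L²(Ω,ℱ,P;H). Fix an integer M ≥ 1, δ ∈ (0, 1/M), and ε ∈ (0,1). For every n ∈ ℕ, set 𝒳_n = σ(x₀,…,x_n) and define: for i = 1,…,M, k_{i,n} is a copy of k (identically distributed with k) independent of 𝒳_n, and p_{i,n} = T_{k_{i,n}} x_n; (β_{i,n})_{1≤i≤M} are [0,1]-valued random variables with Σ_{i=1}^M β_{i,n} = 1 P-a.s. and, for every i, β_{i,n} ≥ δ on the event [‖p_{i,n} − x_n‖ = max_{1≤j≤M} ‖p_{j,n} − x_n‖]; p_n = Σ_{i=1}^M β_{i,n} p_{i,n}; L_n = (Σ_{i=1}^M β_{i,n} ‖p_{i,n} − x_n‖² + 1_{[p_n = x_n]}) / (‖p_n − x_n‖² + 1_{[p_n = x_n]}); a_n = x_n + L_n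 (p_n − x_n); λ_n : Ω → [ε,1] is measurable; r_n = x_n + λ_n (a_n − x_n); and x_{n+1}(ω) = Q(x₀(ω), x_n(ω), r_n(ω)) for every ω. Then Z is a nonempty closed convex subset of H and (x_n) converges strongly P-a.s. and strongly in L²(Ω,ℱ,P;H) to proj_Z x₀. -/

import Mathlib

open MeasureTheory Filter RealInnerProductSpace Topology

/-- The half-space `H(x,y) = {z : ⟪z - y, x - y⟫ ≤ 0}`. -/
def halfSpace {H : Type*} [NormedAddCommGroup H] [InnerProductSpace ℝ H] (x y : H) : Set H :=
  {z : H | ⟪z - y, x - y⟫ ≤ 0}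

open scoped Classical in
/-- The outer set `O(x,y,z)`. -/
noncomputable def Oset {H : Type*} [NormedAddCommGroup H] [InnerProductSpace ℝ H]
    (x y z : H) : Set H :=
  if (halfSpace x y ∩ halfSpace y z).Nonempty then halfSpace x y ∩ halfSpace y z else {y}

/-- `q` is the metric projection of `x` onto `C`. -/
def IsProjPt {H : Type*} [NormedAddCommGroup H] [InnerProductSpace ℝ H]
    (C : Set H) (x q : H) : Prop :=
  q ∈ C ∧ ∀ w ∈ C, ‖x - q‖ ≤ ‖x - w‖

/-- `T` is firmly quasinonexpansive. -/
def FirmlyQNE {H : Type*} [NormedAddCommGroup H] [InnerProductSpace ℝ H] (T : H → H) : Prop :=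
  ∀ x y : H, T y = y → ‖T x - y‖ ^ 2 + ‖T x - x‖ ^ 2 ≤ ‖x - y‖ ^ 2


section Projection

variable {H : Type*} [NormedAddCommGroup H] [InnerProductSpace ℝ H]

theorem norm_sub_sq_eq_add_sub_inner (x q w : H) :
    ‖x - w‖ ^ 2 = ‖x - q‖ ^ 2 + ‖w - q‖ ^ 2 - 2 * ⟪w - q, x - q⟫ := by
  have h := norm_sub_sq_real (x - q) (w - q)
  rw [sub_sub_sub_cancel_right, real_inner_comm] at h
  linarith

/-- The variational inequality satisfied by a projection onto a convex set. -/
theorem IsProjPt.inner_le_zero {C : Set H} {x q : H} (h : IsProjPt C x q) (hC : Convex ℝ C)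
    {w : H} (hw : w ∈ C) : ⟪w - q, x - q⟫ ≤ 0 := by
  have : Nonempty C := ⟨⟨q, h.1⟩⟩
  have hinf : ‖x - q‖ = ⨅ w : C, ‖x - w‖ :=
    le_antisymm (le_ciInf fun w => h.2 w w.2)
      (ciInf_le (f := fun w : C => ‖x - w‖) ⟨0, by rintro _ ⟨w, rfl⟩; positivity⟩ ⟨q, h.1⟩)
  rw [real_inner_comm]
  exact (norm_eq_iInf_iff_real_inner_le_zero hC h.1).1 hinf w hw

/-- A point satisfying the variational inequality is the only projection point. -/
theorem IsProjPt.eq_of_inner_le_zero {C : Set H} {x q q' : H} (h : IsProjPt C x q)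
    (hq' : q' ∈ C) (hvar : ∀ w ∈ C, ⟪w - q', x - q'⟫ ≤ 0) : q = q' := by
  have h1 := norm_sub_sq_eq_add_sub_inner x q' q
  have h2 := hvar q h.1
  have h3 := pow_le_pow_left₀ (norm_nonneg _) (h.2 q' hq') 2
  have h4 : ‖q - q'‖ ^ 2 = 0 := le_antisymm (by linarith) (by positivity)
  exact sub_eq_zero.1 (norm_eq_zero.1 (pow_eq_zero_iff two_ne_zero |>.1 h4))

theorem convex_halfSpace (x y : H) : Convex ℝ (halfSpace x y) := by
  intro u hu v hv a b ha hb hab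
  simp only [halfSpace, Set.mem_ofPred_eq] at *
  have : a • u + b • v - y = a • (u - y) + b • (v - y) := by
    rw [show a • (u - y) + b • (v - y) = a • u + b • v - (a + b) • y by module, hab, one_smul]
  rw [this, inner_add_left, real_inner_smul_left, real_inner_smul_left]
  nlinarith [mul_nonneg ha (neg_nonneg.2 hu), mul_nonneg hb (neg_nonneg.2 hv)]

theorem mem_halfSpace_iff {x y z : H} : z ∈ halfSpace x y ↔ ‖y - x‖ ^ 2 ≤ ⟪z - x, y - x⟫ := by
  rw [halfSpace, Set.mem_ofPred_eq, ← sub_add_sub_cancel z x y, inner_add_left,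
    real_inner_self_eq_norm_sq, norm_sub_rev x y, ← neg_sub y x, inner_neg_right]
  constructor <;> intro h <;> linarith

theorem norm_sub_sq_add_le_of_mem_halfSpace {x y w : H} (h : w ∈ halfSpace x y) :
    ‖x - y‖ ^ 2 + ‖w - y‖ ^ 2 ≤ ‖x - w‖ ^ 2 := by
  have := norm_sub_sq_eq_add_sub_inner x y w
  have h' : ⟪w - y, x - y⟫ ≤ 0 := h
  linarith

theorem norm_sub_le_of_mem_halfSpace {x y w : H} (h : w ∈ halfSpace x y) :
    ‖y - x‖ ≤ ‖w - x‖ := by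
  rw [norm_sub_rev y, norm_sub_rev w]
  refine le_of_sq_le_sq ?_ (norm_nonneg _)
  linarith [norm_sub_sq_add_le_of_mem_halfSpace h, sq_nonneg ‖w - y‖]

open scoped Classical in
/-- Haugazeau's closed form for the projection of `x` onto `H(x,y) ∩ H(y,z)`. -/
noncomputable def haugazeauPoint (t : H × H × H) : H :=
  let u := t.1 - t.2.1
  let v := t.2.1 - t.2.2
  let χ := ⟪u, v⟫
  let ρ := ‖u‖ ^ 2 * ‖v‖ ^ 2 - χ ^ 2
  if ρ ≤ 0 then t.2.2
  else if ρ ≤ χ * ‖v‖ ^ 2 then t.2.1 + (u - (1 + χ / ‖v‖ ^ 2) • v)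
  else t.2.1 + (‖v‖ ^ 2 / ρ) • (χ • u - ‖u‖ ^ 2 • v)

theorem measurable_haugazeauPoint [MeasurableSpace H] [BorelSpace H]
    [SecondCountableTopology H] : Measurable (haugazeauPoint (H := H)) := by
  unfold haugazeauPoint
  dsimp only
  refine Measurable.ite (measurableSet_le (by fun_prop) (by fun_prop)) (by fun_prop) ?_
  exact Measurable.ite (measurableSet_le (by fun_prop) (by fun_prop)) (by fun_prop) (by fun_prop)

theorem IsProjPt.eq_haugazeauPoint {x y z q : H}
    (hne : (halfSpace x y ∩ halfSpace y z).Nonempty)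
    (h : IsProjPt (halfSpace x y ∩ halfSpace y z) x q) : q = haugazeauPoint (x, y, z) := by
  unfold haugazeauPoint
  dsimp only
  set u := x - y with hu
  set v := y - z with hv
  set χ := ⟪u, v⟫ with hχ
  have hmem : ∀ s : H, y + s ∈ halfSpace x y ∩ halfSpace y z ↔
      ⟪s, u⟫ ≤ 0 ∧ ⟪s, v⟫ + ‖v‖ ^ 2 ≤ 0 := by
    intro s
    have : y + s - z = s + v := by rw [hv]; abel
    simp only [halfSpace, Set.mem_inter_iff, Set.mem_ofPred_eq, add_sub_cancel_left, this, ← hu,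
      ← hv, inner_add_left, real_inner_self_eq_norm_sq]
  have key : ∀ s : H, ⟪s, u⟫ ≤ 0 → ⟪s, v⟫ + ‖v‖ ^ 2 ≤ 0 →
      (∀ w : H, ⟪w, u⟫ ≤ 0 → ⟪w, v⟫ + ‖v‖ ^ 2 ≤ 0 → ⟪w - s, u - s⟫ ≤ 0) → q = y + s := by
    intro s h1 h2 h3
    refine h.eq_of_inner_le_zero ((hmem s).2 ⟨h1, h2⟩) fun w hw => ?_
    have hw' := (hmem (w - y)).1 (by rwa [add_sub_cancel])
    have := h3 (w - y) hw'.1 hw'.2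
    rwa [sub_sub, hu, sub_sub] at this
  have hvu : ⟪v, u⟫ = χ := real_inner_comm _ _
  split_ifs with h1 h2
  · obtain ⟨w, hw⟩ := hne
    have hw' := (hmem (w - y)).1 (by rwa [add_sub_cancel])
    have hz : z = y + -v := by rw [hv]; abel
    rw [hz]
    rcases eq_or_ne v 0 with hv0 | hv0
    · refine key _ (by simp [hv0]) (by simp [hv0]) fun w hw1 _ => by simpa [hv0] using hw1
    have hνpos : 0 < ‖v‖ ^ 2 := by positivity
    have hcoll : u = (χ / ‖v‖ ^ 2) • v := by
      rw [← sub_eq_zero, ← norm_eq_zero, ← pow_eq_zero_iff two_ne_zero]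
      refine le_antisymm ?_ (by positivity)
      rw [norm_sub_sq_real, real_inner_smul_right, norm_smul, ← hχ, mul_pow, Real.norm_eq_abs,
        sq_abs]
      have : ‖u‖ ^ 2 - 2 * (χ / ‖v‖ ^ 2 * χ) + (χ / ‖v‖ ^ 2) ^ 2 * ‖v‖ ^ 2
          = (‖u‖ ^ 2 * ‖v‖ ^ 2 - χ ^ 2) / ‖v‖ ^ 2 := by
        field_simp; ring
      rw [this]
      exact div_nonpos_of_nonpos_of_nonneg h1 hνpos.le
    have ht : 0 ≤ χ / ‖v‖ ^ 2 := by
      by_contra! hneg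
      have := hw'.1
      rw [hcoll, real_inner_smul_right] at this
      nlinarith [hw'.2]
    have hχ0 : 0 ≤ χ := by
      have := mul_nonneg ht hνpos.le
      rwa [div_mul_cancel₀ _ hνpos.ne'] at this
    refine key _ (by rw [inner_neg_left, hvu]; linarith)
      (by rw [inner_neg_left, real_inner_self_eq_norm_sq]; linarith) fun w hw1 hw2 => ?_
    rw [sub_neg_eq_add, sub_neg_eq_add, inner_add_left, inner_add_right, inner_add_right, hvu,
      real_inner_self_eq_norm_sq]
    have e1 : ⟪w, u⟫ = χ / ‖v‖ ^ 2 * ⟪w, v⟫ := by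
      conv_lhs => rw [hcoll]
      rw [real_inner_smul_right]
    have e2 : χ = χ / ‖v‖ ^ 2 * ‖v‖ ^ 2 := by field_simp
    rw [e1]
    nlinarith
  · push Not at h1
    have hν : 0 < ‖v‖ ^ 2 := by
      rcases (sq_nonneg ‖v‖).eq_or_lt with h0 | h0
      · rw [← h0] at h1; nlinarith [sq_nonneg χ]
      · exact h0
    have hv0 : ‖v‖ ≠ 0 := fun h0 => by simp [h0] at hν
    have hχ0 : 0 ≤ χ := by
      by_contra! hneg
      nlinarith
    have ht : 0 ≤ χ / ‖v‖ ^ 2 := by positivity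
    have hsv : ⟪u - (1 + χ / ‖v‖ ^ 2) • v, v⟫ + ‖v‖ ^ 2 = 0 := by
      rw [inner_sub_left, real_inner_smul_left, real_inner_self_eq_norm_sq, ← hχ]
      field_simp; ring
    refine key _ ?_ hsv.le fun w hw1 hw2 => ?_
    · rw [inner_sub_left, real_inner_smul_left, real_inner_self_eq_norm_sq, hvu]
      have : ‖u‖ ^ 2 - (1 + χ / ‖v‖ ^ 2) * χ
          = ((‖u‖ ^ 2 * ‖v‖ ^ 2 - χ ^ 2) - χ * ‖v‖ ^ 2) / ‖v‖ ^ 2 := by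
        field_simp; ring
      rw [this]
      exact div_nonpos_of_nonpos_of_nonneg (by linarith) hν.le
    · rw [sub_sub_cancel, real_inner_smul_right, inner_sub_left]
      nlinarith
  · push Not at h1 h2
    set ρ := ‖u‖ ^ 2 * ‖v‖ ^ 2 - χ ^ 2 with hρ
    set s := (‖v‖ ^ 2 / ρ) • (χ • u - ‖u‖ ^ 2 • v) with hs
    have hsu : ⟪s, u⟫ = 0 := by
      rw [hs, real_inner_smul_left, inner_sub_left, real_inner_smul_left, real_inner_smul_left,
        hvu, real_inner_self_eq_norm_sq]
      ring
    have hsv : ⟪s, v⟫ + ‖v‖ ^ 2 = 0 := by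
      rw [hs, real_inner_smul_left, inner_sub_left, real_inner_smul_left, real_inner_smul_left,
        ← hχ, real_inner_self_eq_norm_sq]
      have : χ * χ - ‖u‖ ^ 2 * ‖v‖ ^ 2 = -ρ := by rw [hρ]; ring
      rw [this]
      field_simp; ring
    refine key _ hsu.le hsv.le fun w hw1 hw2 => ?_
    have hdec : u - s = (1 - ‖v‖ ^ 2 * χ / ρ) • u + (‖v‖ ^ 2 * ‖u‖ ^ 2 / ρ) • v := by
      rw [hs, smul_sub, smul_smul, smul_smul, sub_smul, one_smul]
      module
    have hc1 : 0 ≤ 1 - ‖v‖ ^ 2 * χ / ρ := by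
      rw [sub_nonneg, div_le_one h1]; linarith
    have hc2 : 0 ≤ ‖v‖ ^ 2 * ‖u‖ ^ 2 / ρ := by positivity
    rw [hdec, inner_add_right, real_inner_smul_right, real_inner_smul_right, inner_sub_left,
      inner_sub_left, hsu]
    nlinarith [mul_nonneg hc1 (neg_nonneg.2 hw1), mul_nonneg hc2 (neg_nonneg.2 hw2)]

end Projection

section FirmlyQuasinonexpansive

variable {H : Type*} [NormedAddCommGroup H] [InnerProductSpace ℝ H]

theorem FirmlyQNE.norm_sq_le_inner {T : H → H} (hT : FirmlyQNE T) (x : H) {y : H}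
    (hy : T y = y) : ‖T x - x‖ ^ 2 ≤ ⟪y - x, T x - x⟫ := by
  have h1 := hT x y hy
  have h2 := norm_sub_sq_eq_add_sub_inner (T x) x y
  rw [norm_sub_rev y x] at h2
  linarith

theorem FirmlyQNE.isClosed_fixedPoints {T : H → H} (hT : FirmlyQNE T) :
    IsClosed {z | T z = z} := by
  refine IsSeqClosed.isClosed fun z w hz hw => ?_
  have hlim : Tendsto (fun n => ‖w - z n‖ ^ 2) atTop (𝓝 0) := by
    simpa using ((tendsto_const_nhds (x := w)).sub hw).norm.pow 2
  have h0 : ‖T w - w‖ ^ 2 ≤ 0 :=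
    ge_of_tendsto' hlim fun n => by
      have := hT w (z n) (hz n)
      linarith [sq_nonneg ‖T w - z n‖]
  have h1 : ‖T w - w‖ ^ 2 = 0 := le_antisymm h0 (by positivity)
  exact sub_eq_zero.1 (norm_eq_zero.1 (pow_eq_zero_iff two_ne_zero |>.1 h1))

theorem FirmlyQNE.convex_fixedPoints {T : H → H} (hT : FirmlyQNE T) :
    Convex ℝ {z | T z = z} := by
  intro u hu v hv a b ha hb hab
  set z := a • u + b • v with hz
  have h1 := mul_le_mul_of_nonneg_left (hT.norm_sq_le_inner z hu) ha
  have h2 := mul_le_mul_of_nonneg_left (hT.norm_sq_le_inner z hv) hb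
  have h3 : a * ⟪u - z, T z - z⟫ + b * ⟪v - z, T z - z⟫ = 0 := by
    rw [← real_inner_smul_left, ← real_inner_smul_left, ← inner_add_left]
    have : a • (u - z) + b • (v - z) = 0 := by
      have : a • (u - z) + b • (v - z) = z - (a + b) • z := by rw [hz]; module
      rw [this, hab, one_smul, sub_self]
    rw [this, inner_zero_left]
  have h4 : ‖T z - z‖ ^ 2 = 0 := by
    refine le_antisymm ?_ (by positivity)
    have : a * ‖T z - z‖ ^ 2 + b * ‖T z - z‖ ^ 2 = ‖T z - z‖ ^ 2 := by
      rw [← add_mul, hab, one_mul]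
    linarith
  exact sub_eq_zero.1 (norm_eq_zero.1 (pow_eq_zero_iff two_ne_zero |>.1 h4))

end FirmlyQuasinonexpansive

theorem mul_norm_sub_sq_le_sum {E ι : Type*} [SeminormedAddCommGroup E] [Fintype ι] {β : ι → ℝ}
    (hβ0 : ∀ i, 0 ≤ β i) {p : ι → E} {x : E} {δ : ℝ}
    (hβδ : ∀ i, (∀ j, ‖p j - x‖ ≤ ‖p i - x‖) → δ ≤ β i) (j : ι) :
    δ * ‖p j - x‖ ^ 2 ≤ ∑ i, β i * ‖p i - x‖ ^ 2 := by
  have : Nonempty ι := ⟨j⟩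
  obtain ⟨i, hi⟩ := Finite.exists_max fun i => ‖p i - x‖
  calc δ * ‖p j - x‖ ^ 2 ≤ β i * ‖p i - x‖ ^ 2 :=
        mul_le_mul (hβδ i hi) (pow_le_pow_left₀ (norm_nonneg _) (hi j) 2) (by positivity) (hβ0 i)
    _ ≤ _ := Finset.single_le_sum (f := fun i => β i * ‖p i - x‖ ^ 2)
        (fun i _ => mul_nonneg (hβ0 i) (sq_nonneg _)) (Finset.mem_univ i)

section Extrapolation

variable {H : Type*} [NormedAddCommGroup H] [InnerProductSpace ℝ H] {ι : Type*} [Fintype ι]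

theorem sum_smul_sub_eq {β : ι → ℝ} (hβ : ∑ i, β i = 1) (p : ι → H) (x : H) :
    ∑ i, β i • (p i - x) = ∑ i, β i • p i - x := by
  simp_rw [smul_sub, Finset.sum_sub_distrib, ← Finset.sum_smul, hβ, one_smul]

/-- Jensen's inequality for the squared norm. -/
theorem norm_sum_smul_sub_sq_le {β : ι → ℝ} (hβ0 : ∀ i, 0 ≤ β i) (hβ : ∑ i, β i = 1)
    (p : ι → H) (x : H) :
    ‖∑ i, β i • p i - x‖ ^ 2 ≤ ∑ i, β i * ‖p i - x‖ ^ 2 := by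
  set m := ∑ i, β i • p i with hm
  have h1 : ∑ i, β i * ⟪p i - m, x - m⟫ = 0 := by
    simp_rw [← real_inner_smul_left]
    rw [← sum_inner, sum_smul_sub_eq hβ, ← hm, sub_self, inner_zero_left]
  have h2 : ∀ i, β i * ‖p i - x‖ ^ 2 =
      β i * ‖m - x‖ ^ 2 + β i * ‖p i - m‖ ^ 2 - 2 * (β i * ⟪p i - m, x - m⟫) := fun i => by
    rw [norm_sub_rev (p i) x, norm_sub_sq_eq_add_sub_inner x m (p i), norm_sub_rev x m]
    ring
  simp_rw [h2]
  rw [Finset.sum_sub_distrib, Finset.sum_add_distrib, ← Finset.mul_sum, h1, ← Finset.sum_mul, hβ]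
  have : 0 ≤ ∑ i, β i * ‖p i - m‖ ^ 2 :=
    Finset.sum_nonneg fun i _ => mul_nonneg (hβ0 i) (sq_nonneg _)
  linarith

open scoped Classical in
/-- The extrapolated average `a` is at least as far from `x` as the root mean square of the
displacements, and `z` lies in the half-space `H(x, a)`. -/
theorem extrapolation_bounds {β : ι → ℝ} (hβ0 : ∀ i, 0 ≤ β i) (hβ : ∑ i, β i = 1)
    {p : ι → H} {x z m a : H} {L : ℝ} (hm : m = ∑ i, β i • p i)
    (hz : ∀ i, ‖p i - x‖ ^ 2 ≤ ⟪z - x, p i - x⟫)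
    (hL : L = ((∑ i, β i * ‖p i - x‖ ^ 2) + (if m = x then (1 : ℝ) else 0)) /
        (‖m - x‖ ^ 2 + (if m = x then (1 : ℝ) else 0)))
    (ha : a = x + L • (m - x)) :
    ∑ i, β i * ‖p i - x‖ ^ 2 ≤ ‖a - x‖ ^ 2 ∧ ‖a - x‖ ^ 2 ≤ ⟪z - x, a - x⟫ := by
  have hJ := norm_sum_smul_sub_sq_le hβ0 hβ p x
  rw [← hm] at hJ
  have hS : ∑ i, β i * ‖p i - x‖ ^ 2 ≤ ⟪z - x, m - x⟫ := by
    rw [hm, ← sum_smul_sub_eq hβ, inner_sum]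
    refine Finset.sum_le_sum fun i _ => ?_
    rw [real_inner_smul_right]
    exact mul_le_mul_of_nonneg_left (hz i) (hβ0 i)
  set S := ∑ i, β i * ‖p i - x‖ ^ 2
  have hax : a - x = L • (m - x) := by rw [ha, add_sub_cancel_left]
  rw [hax, real_inner_smul_right, norm_smul, mul_pow, Real.norm_eq_abs, sq_abs]
  rcases eq_or_ne m x with h | h
  · rw [h, sub_self] at hS ⊢
    simpa using hS
  · simp only [h, if_false, add_zero] at hL
    have hpos : 0 < ‖m - x‖ ^ 2 := by
      have := norm_pos_iff.2 (sub_ne_zero.2 h)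
      positivity
    have hLS : L * ‖m - x‖ ^ 2 = S := by rw [hL, div_mul_cancel₀ _ hpos.ne']
    have hL1 : 1 ≤ L := by rw [hL, one_le_div hpos]; exact hJ
    constructor <;> nlinarith

end Extrapolation

section HaugazeauOrbit

variable {H : Type*} [NormedAddCommGroup H] [InnerProductSpace ℝ H]

theorem Oset_eq_inter {x y z : H} (h : (halfSpace x y ∩ halfSpace y z).Nonempty) :
    Oset x y z = halfSpace x y ∩ halfSpace y z := if_pos h

variable {x r : ℕ → H} {Z : Set H}

theorem haugazeau_subset
    (hZ : Z.Nonempty) (hr : ∀ n, Z ⊆ halfSpace (x n) (r n))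
    (hx : ∀ n, IsProjPt (Oset (x 0) (x n) (r n)) (x 0) (x (n + 1))) (n : ℕ) :
    Z ⊆ halfSpace (x 0) (x n) := by
  induction n with
  | zero => intro z _; simp [halfSpace]
  | succ n ih =>
    have hsub := Set.subset_inter ih (hr n)
    have h := hx n
    rw [Oset_eq_inter (hZ.mono hsub)] at h
    exact fun z hz => h.inner_le_zero ((convex_halfSpace _ _).inter (convex_halfSpace _ _))
      (hsub hz)

theorem haugazeau_isProjPt
    (hZ : Z.Nonempty) (hr : ∀ n, Z ⊆ halfSpace (x n) (r n))
    (hx : ∀ n, IsProjPt (Oset (x 0) (x n) (r n)) (x 0) (x (n + 1))) (n : ℕ) :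
    (halfSpace (x 0) (x n) ∩ halfSpace (x n) (r n)).Nonempty ∧
      IsProjPt (halfSpace (x 0) (x n) ∩ halfSpace (x n) (r n)) (x 0) (x (n + 1)) := by
  have hne := hZ.mono (Set.subset_inter (haugazeau_subset hZ hr hx n) (hr n))
  exact ⟨hne, Oset_eq_inter hne ▸ hx n⟩

theorem haugazeau_norm_le
    (hZ : Z.Nonempty) (hr : ∀ n, Z ⊆ halfSpace (x n) (r n))
    (hx : ∀ n, IsProjPt (Oset (x 0) (x n) (r n)) (x 0) (x (n + 1)))
    {z : H} (hz : z ∈ Z) (n : ℕ) : ‖x 0 - x n‖ ≤ ‖x 0 - z‖ := by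
  rw [norm_sub_rev, norm_sub_rev _ z]
  exact norm_sub_le_of_mem_halfSpace (haugazeau_subset hZ hr hx n hz)

theorem haugazeau_sum_le
    (hZ : Z.Nonempty) (hr : ∀ n, Z ⊆ halfSpace (x n) (r n))
    (hx : ∀ n, IsProjPt (Oset (x 0) (x n) (r n)) (x 0) (x (n + 1)))
    {z : H} (hz : z ∈ Z) (N : ℕ) :
    ∑ n ∈ Finset.range N, ‖r n - x n‖ ^ 2 ≤ ‖x 0 - z‖ ^ 2 := by
  have hstep : ∀ n, ‖r n - x n‖ ^ 2 ≤ ‖x 0 - x (n + 1)‖ ^ 2 - ‖x 0 - x n‖ ^ 2 := fun n => by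
    have hmem := (haugazeau_isProjPt hZ hr hx n).2.1
    have h1 := norm_sub_sq_add_le_of_mem_halfSpace hmem.1
    have h2 := pow_le_pow_left₀ (norm_nonneg _) (norm_sub_le_of_mem_halfSpace hmem.2) 2
    linarith
  calc _ ≤ ∑ n ∈ Finset.range N, (‖x 0 - x (n + 1)‖ ^ 2 - ‖x 0 - x n‖ ^ 2) :=
        Finset.sum_le_sum fun n _ => hstep n
    _ = ‖x 0 - x N‖ ^ 2 := by
        rw [Finset.sum_range_sub (fun n => ‖x 0 - x n‖ ^ 2)]; simp
    _ ≤ _ := pow_le_pow_left₀ (norm_nonneg _) (haugazeau_norm_le hZ hr hx hz N) 2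

end HaugazeauOrbit

section WeakConvergence

variable {H : Type*} [NormedAddCommGroup H] [InnerProductSpace ℝ H] [CompleteSpace H]
  [SecondCountableTopology H]

theorem exists_weakly_convergent_subseq {y : ℕ → H} {R : ℝ} (hy : ∀ n, ‖y n‖ ≤ R) :
    ∃ (w : H) (φ : ℕ → ℕ), StrictMono φ ∧
      ∀ v : H, Tendsto (fun n => ⟪y (φ n), v⟫) atTop (𝓝 ⟪w, v⟫) := by
  obtain ⟨f, -, φ, hφ, hlim⟩ := WeakDual.isSeqCompact_closedBall ℝ H 0 R
    (x := fun n => StrongDual.toWeakDual (InnerProductSpace.toDual ℝ H (y n)))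
    (fun n => by simpa using hy n)
  refine ⟨(InnerProductSpace.toDual ℝ H).symm (WeakDual.toStrongDual f), φ, hφ, fun v => ?_⟩
  rw [InnerProductSpace.toDual_symm_apply]
  exact ((WeakDual.eval_continuous v).tendsto f).comp hlim

/-- A sequence in the ball around `x₀` through `proj_Z x₀` whose weak cluster points all lie in `Z`
converges strongly to `proj_Z x₀`. -/
theorem IsProjPt.tendsto_of_weak_cluster_mem {Z : Set H} (hZ : Convex ℝ Z) {x₀ q : H}
    (hq : IsProjPt Z x₀ q) {x : ℕ → H} (hx : ∀ n, ‖x₀ - x n‖ ≤ ‖x₀ - q‖)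
    (hcl : ∀ (φ : ℕ → ℕ) (w : H), Tendsto φ atTop atTop →
      (∀ v : H, Tendsto (fun n => ⟪x (φ n), v⟫) atTop (𝓝 ⟪w, v⟫)) → w ∈ Z) :
    Tendsto x atTop (𝓝 q) := by
  refine tendsto_of_subseq_tendsto fun ψ hψ => ?_
  obtain ⟨w, φ, hφ, hw⟩ := exists_weakly_convergent_subseq (y := fun n => x (ψ n))
    (R := ‖x₀‖ + ‖x₀ - q‖) fun n => by
      have := norm_sub_le x₀ (x₀ - x (ψ n))
      rw [sub_sub_cancel] at this
      linarith [hx (ψ n)]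
  refine ⟨φ, ?_⟩
  have hwZ := hcl (fun n => ψ (φ n)) w (hψ.comp hφ.tendsto_atTop) hw
  have hvar := hq.inner_le_zero hZ hwZ
  have hbound : ∀ n, ‖x n - q‖ ^ 2 ≤ 2 * (⟪x n, x₀ - q⟫ - ⟪q, x₀ - q⟫) := fun n => by
    have h1 := norm_sub_sq_eq_add_sub_inner x₀ q (x n)
    have h2 := pow_le_pow_left₀ (norm_nonneg _) (hx n) 2
    rw [inner_sub_left] at h1
    linarith
  have hlim := ((hw (x₀ - q)).sub_const ⟪q, x₀ - q⟫).const_mul 2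
  rw [← inner_sub_left] at hlim
  have hzero : ⟪w - q, x₀ - q⟫ = 0 := le_antisymm hvar <| by
    have := ge_of_tendsto' hlim fun n => (sq_nonneg _).trans (hbound (ψ (φ n)))
    linarith
  rw [hzero, mul_zero] at hlim
  have hsq := squeeze_zero (fun n => sq_nonneg _) (fun n => hbound (ψ (φ n))) hlim
  rw [tendsto_iff_norm_sub_tendsto_zero]
  simpa [Real.sqrt_sq (norm_nonneg _)] using hsq.sqrt

end WeakConvergence

section Independence

open ProbabilityTheory ENNReal

theorem ae_ae_tendsto_zero_of_tsum_le {Ω K E : Type*} [MeasurableSpace Ω] [MeasurableSpace K]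
    [MeasurableSpace E] {μ : Measure Ω} [IsFiniteMeasure μ] {ν : Measure K} [SFinite ν]
    {g : K × E → ℝ≥0∞} (hg : Measurable g) {X : ℕ → Ω → E} {κ : ℕ → Ω → K}
    (hX : ∀ n, AEMeasurable (X n) μ) (hκ : ∀ n, Measurable (κ n))
    (hlaw : ∀ n, μ.map (κ n) = ν) (hindep : ∀ n, IndepFun (κ n) (X n) μ)
    {B : Ω → ℝ≥0∞} (hB : ∫⁻ ω, B ω ∂μ ≠ ∞)
    (hsum : ∀ᵐ ω ∂μ, ∑' n, g (κ n ω, X n ω) ≤ B ω) :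
    ∀ᵐ ω ∂μ, ∀ᵐ c ∂ν, Tendsto (fun n => g (c, X n ω)) atTop (𝓝 0) := by
  have hpair : ∀ n, AEMeasurable (fun ω => (κ n ω, X n ω)) μ := fun n =>
    (hκ n).aemeasurable.prodMk (hX n)
  have hinner : Measurable fun e => ∫⁻ c, g (c, e) ∂ν := hg.lintegral_prod_left'
  have hinnerX : ∀ n, AEMeasurable (fun ω => ∫⁻ c, g (c, X n ω) ∂ν) μ := fun n =>
    hinner.comp_aemeasurable (hX n)
  have hgX : ∀ n, AEMeasurable (fun ω => g (κ n ω, X n ω)) μ := fun n =>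
    hg.comp_aemeasurable (hpair n)
  have hfub : ∀ n, ∫⁻ ω, g (κ n ω, X n ω) ∂μ = ∫⁻ ω, ∫⁻ c, g (c, X n ω) ∂ν ∂μ := fun n => by
    rw [← lintegral_map' hg.aemeasurable (hpair n),
      (hindep n).map_prod_eq_prod_map_map (hκ n).aemeasurable (hX n), hlaw n,
      lintegral_prod_symm' _ hg, lintegral_map' hinner.aemeasurable (hX n)]
  have hfin : ∫⁻ ω, ∑' n, ∫⁻ c, g (c, X n ω) ∂ν ∂μ ≠ ∞ := by
    rw [lintegral_tsum hinnerX]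
    simp_rw [← hfub]
    rw [← lintegral_tsum hgX]
    exact ne_top_of_le_ne_top hB (lintegral_mono_ae hsum)
  filter_upwards [ae_lt_top' (AEMeasurable.tsum hinnerX) hfin] with ω hω
  have hgm : ∀ n, Measurable fun c => g (c, X n ω) := fun n => hg.comp (by fun_prop)
  rw [← lintegral_tsum fun n => (hgm n).aemeasurable] at hω
  filter_upwards [ae_lt_top (Measurable.tsum hgm) hω.ne] with c hc
  exact ENNReal.tendsto_atTop_zero_of_tsum_ne_top hc.ne

end Independence

open scoped Classical in
/-- Theorem 4.2: the randomly activated block-iterative Haugazeau method converges strongly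
a.s. and strongly in `L²` to the projection of `x₀` onto the common fixed point set `Z`. -/
theorem random_block_haugazeau_convergence
    {Ω : Type*} [MeasurableSpace Ω] (μ : Measure Ω)
    [IsProbabilityMeasure μ] [μ.IsComplete]
    {H : Type*} [NormedAddCommGroup H] [InnerProductSpace ℝ H] [CompleteSpace H]
    [SecondCountableTopology H] [MeasurableSpace H] [BorelSpace H]
    {K : Type*} [MeasurableSpace K]
    (T : K → H → H)
    (hTfqne : ∀ κ : K, FirmlyQNE (T κ))
    (hTmeas : Measurable fun q : K × H => T q.1 q.2)
    (hTdemi : ∀ κ : K, ∀ (y : ℕ → H) (w : H),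
      (∀ v : H, Tendsto (fun n => ⟪y n, v⟫) atTop (𝓝 ⟪w, v⟫)) →
      Tendsto (fun n => y n - T κ (y n)) atTop (𝓝 0) → T κ w = w)
    (k : Ω → K) (hk : Measurable k)
    (Z : Set H) (hZ : Z = {z : H | ∀ᵐ ω ∂μ, T (k ω) z = z}) (hZne : Z.Nonempty)
    (x0 : Ω → H) (hx0 : MemLp x0 2 μ)
    (M : ℕ) (hM : 1 ≤ M) (δ ε : ℝ)
    (hδ : δ ∈ Set.Ioo (0 : ℝ) (1 / (M : ℝ))) (hε : ε ∈ Set.Ioo (0 : ℝ) 1)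
    (x : ℕ → Ω → H) (hxinit : x 0 = x0)
    (kk : ℕ → Fin M → Ω → K) (hkkmeas : ∀ n i, Measurable (kk n i))
    (hkkcopy : ∀ n i, ∀ S : Set K, MeasurableSet S → μ (kk n i ⁻¹' S) = μ (k ⁻¹' S))
    (hkkindep : ∀ n i, ProbabilityTheory.Indep
      (MeasurableSpace.comap (kk n i) inferInstance)
      (⨆ j : Fin (n + 1), MeasurableSpace.comap (x j) inferInstance) μ)
    (p : ℕ → Fin M → Ω → H) (hp : ∀ n i ω, p n i ω = T (kk n i ω) (x n ω))
    (β : ℕ → Fin M → Ω → ℝ) (hβmeas : ∀ n i, Measurable (β n i))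
    (hβ01 : ∀ n i ω, β n i ω ∈ Set.Icc (0 : ℝ) 1)
    (hβsum : ∀ n, ∀ᵐ ω ∂μ, ∑ i, β n i ω = 1)
    (hβδ : ∀ n i, ∀ᵐ ω ∂μ,
      (∀ j, ‖p n j ω - x n ω‖ ≤ ‖p n i ω - x n ω‖) → δ ≤ β n i ω)
    (pbar : ℕ → Ω → H) (hpbar : ∀ n ω, pbar n ω = ∑ i, β n i ω • p n i ω)
    (L : ℕ → Ω → ℝ)
    (hL : ∀ n ω, L n ω =
      ((∑ i, β n i ω * ‖p n i ω - x n ω‖ ^ 2) + (if pbar n ω = x n ω then (1 : ℝ) else 0)) /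
        (‖pbar n ω - x n ω‖ ^ 2 + (if pbar n ω = x n ω then (1 : ℝ) else 0)))
    (a : ℕ → Ω → H) (haa : ∀ n ω, a n ω = x n ω + L n ω • (pbar n ω - x n ω))
    (lam : ℕ → Ω → ℝ) (hlammeas : ∀ n, Measurable (lam n))
    (hlam : ∀ n ω, lam n ω ∈ Set.Icc ε 1)
    (r : ℕ → Ω → H) (hr : ∀ n ω, r n ω = x n ω + lam n ω • (a n ω - x n ω))
    (hxsucc : ∀ n ω, IsProjPt (Oset (x0 ω) (x n ω) (r n ω)) (x0 ω) (x (n + 1) ω)) :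
    IsClosed Z ∧ Convex ℝ Z ∧
    ∀ q : Ω → H, (∀ ω, IsProjPt Z (x0 ω) (q ω)) →
      (∀ᵐ ω ∂μ, Tendsto (fun n => x n ω) atTop (𝓝 (q ω))) ∧
      Tendsto (fun n => ∫ ω, ‖x n ω - q ω‖ ^ 2 ∂μ) atTop (𝓝 0) := by
  subst hxinit
  have hε0 : 0 < ε := hε.1
  have hδ0 : 0 < δ := hδ.1
  have hfixmeas : ∀ z, MeasurableSet {c | T c z = z} := fun z =>
    measurableSet_eq_fun (hTmeas.comp measurable_prodMk_right) measurable_const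
  have hlaw : ∀ n i, μ.map (kk n i) = μ.map k := fun n i => Measure.ext fun S hS => by
    rw [Measure.map_apply (hkkmeas n i) hS, Measure.map_apply hk hS, hkkcopy n i S hS]
  have hmemZ : ∀ {z}, z ∈ Z ↔ ∀ᵐ c ∂μ.map k, T c z = z := fun {z} => by
    rw [hZ, ae_map_iff hk.aemeasurable (hfixmeas z)]
    rfl
  have hZclosed : IsClosed Z := by
    refine IsSeqClosed.isClosed fun z w hz hw => hmemZ.2 ?_
    filter_upwards [ae_all_iff.2 fun n => hmemZ.1 (hz n)] with c hc
    exact (hTfqne c).isClosed_fixedPoints.isSeqClosed hc hw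
  have hZconvex : Convex ℝ Z := by
    intro u hu v hv s t hs ht hst
    refine hmemZ.2 ?_
    filter_upwards [hmemZ.1 hu, hmemZ.1 hv] with c hcu hcv
    exact (hTfqne c).convex_fixedPoints hcu hcv hs ht hst
  refine ⟨hZclosed, hZconvex, fun q hq => ?_⟩
  -- Almost surely, every activated operator fixes every point of `Z`.
  have hfix : ∀ᵐ ω ∂μ, ∀ n i, ∀ z ∈ Z, T (kk n i ω) z = z := by
    obtain ⟨D, hDZ, hDc, hD⟩ :=
      (TopologicalSpace.IsSeparable.of_separableSpace Z).exists_countable_dense_subset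
    have hDfix : ∀ᵐ ω ∂μ, ∀ n i, ∀ z ∈ D, T (kk n i ω) z = z := by
      refine ae_all_iff.2 fun n => ae_all_iff.2 fun i => (ae_ball_iff hDc).2 fun z hz => ?_
      have := hmemZ.1 (hDZ hz)
      rw [← hlaw n i] at this
      exact ae_of_ae_map (hkkmeas n i).aemeasurable this
    filter_upwards [hDfix] with ω hω n i z hz
    exact closure_minimal (fun d hd => hω n i d hd) (hTfqne _).isClosed_fixedPoints (hD hz)
  have hstep : ∀ᵐ ω ∂μ, ∀ n, Z ⊆ halfSpace (x n ω) (r n ω) ∧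
      ∀ i, δ * ε ^ 2 * ‖p n i ω - x n ω‖ ^ 2 ≤ ‖r n ω - x n ω‖ ^ 2 := by
    filter_upwards [hfix, ae_all_iff.2 hβsum, ae_all_iff.2 fun n => ae_all_iff.2 (hβδ n)]
      with ω hω hsum hδβ n
    have hβ0 : ∀ i, 0 ≤ β n i ω := fun i => (hβ01 n i ω).1
    have hlam0 : ε ≤ lam n ω := (hlam n ω).1
    have hlam1 : lam n ω ≤ 1 := (hlam n ω).2
    have hext : ∀ z ∈ Z, _ := fun z hz => extrapolation_bounds hβ0 (hsum n) (z := z) (hpbar n ω)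
      (fun i => by rw [hp]; exact (hTfqne _).norm_sq_le_inner _ (hω n i z hz)) (hL n ω) (haa n ω)
    have hrx : r n ω - x n ω = lam n ω • (a n ω - x n ω) := by rw [hr, add_sub_cancel_left]
    have hnorm : ‖r n ω - x n ω‖ ^ 2 = lam n ω ^ 2 * ‖a n ω - x n ω‖ ^ 2 := by
      rw [hrx, norm_smul, mul_pow, Real.norm_eq_abs, sq_abs]
    refine ⟨fun z hz => mem_halfSpace_iff.2 ?_, fun i => ?_⟩
    · rw [hnorm, hrx, real_inner_smul_right, sq, mul_assoc]
      refine mul_le_mul_of_nonneg_left ?_ (hε0.le.trans hlam0)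
      exact (mul_le_of_le_one_left (sq_nonneg _) hlam1).trans (hext z hz).2
    · obtain ⟨z, hz⟩ := hZne
      rw [hnorm, mul_comm δ, mul_assoc]
      refine mul_le_mul (pow_le_pow_left₀ hε0.le hlam0 2) ?_ (by positivity) (sq_nonneg _)
      exact (mul_norm_sub_sq_le_sum hβ0 (hδβ n) i).trans (hext z hz).1
  have hxmeas : ∀ n, AEMeasurable (x n) μ := by
    intro n
    induction n with
    | zero => exact hx0.aestronglyMeasurable.aemeasurable
    | succ n ih =>
      have hpm : ∀ i, AEMeasurable (p n i) μ := fun i => by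
        rw [funext (hp n i)]
        exact hTmeas.comp_aemeasurable ((hkkmeas n i).aemeasurable.prodMk ih)
      have hβm : ∀ i, AEMeasurable (β n i) μ := fun i => (hβmeas n i).aemeasurable
      have hpbarm : AEMeasurable (pbar n) μ := by
        rw [funext (hpbar n)]
        fun_prop
      have hind : AEMeasurable (fun ω => if pbar n ω = x n ω then (1 : ℝ) else 0) μ :=
        (Measurable.ite (measurableSet_eq_fun measurable_fst measurable_snd) measurable_const
          measurable_const : Measurable fun t : H × H => if t.1 = t.2 then (1 : ℝ) else 0)
          |>.comp_aemeasurable (hpbarm.prodMk ih)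
      have hLm : AEMeasurable (L n) μ := by
        rw [funext (hL n)]
        fun_prop
      have ham : AEMeasurable (a n) μ := by
        rw [funext (haa n)]
        fun_prop
      have hrm : AEMeasurable (r n) μ := by
        rw [funext (hr n)]
        have := (hlammeas n).aemeasurable (μ := μ)
        fun_prop
      refine (measurable_haugazeauPoint.comp_aemeasurable
        (hx0.aestronglyMeasurable.aemeasurable.prodMk (ih.prodMk hrm))).congr ?_
      filter_upwards [hstep] with ω hω
      obtain ⟨hne, hproj⟩ := haugazeau_isProjPt (x := fun n => x n ω) hZne
        (fun n => (hω n).1) (fun n => hxsucc n ω) n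
      exact (hproj.eq_haugazeauPoint hne).symm
  have hindep : ∀ n i, ProbabilityTheory.IndepFun (kk n i) (x n) μ := fun n i => by
    rw [ProbabilityTheory.IndepFun_iff_Indep]
    exact ProbabilityTheory.indep_of_indep_of_le_right (hkkindep n i)
      (le_iSup_of_le (Fin.last n) (by simp))
  obtain ⟨z, hz⟩ := hZne
  have hZne : Z.Nonempty := ⟨z, hz⟩
  have hint : Integrable (fun ω => ‖x 0 ω - z‖ ^ 2) μ :=
    (hx0.sub (memLp_const z)).norm.integrable_sq
  have hnorm_le : ∀ᵐ ω ∂μ, ∀ n, ‖x 0 ω - x n ω‖ ≤ ‖x 0 ω - q ω‖ := by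
    filter_upwards [hstep] with ω hω n
    exact haugazeau_norm_le (x := fun n => x n ω) hZne (fun n => (hω n).1)
      (fun n => hxsucc n ω) (hq ω).1 n
  have hresid : ∀ᵐ ω ∂μ, ∀ᵐ c ∂μ.map k,
      Tendsto (fun n => ENNReal.ofReal (‖T c (x n ω) - x n ω‖ ^ 2)) atTop (𝓝 0) := by
    refine ae_ae_tendsto_zero_of_tsum_le
      (g := fun t : K × H => ENNReal.ofReal (‖T t.1 t.2 - t.2‖ ^ 2)) (by fun_prop) hxmeas
      (fun n => hkkmeas n ⟨0, hM⟩) (fun n => hlaw n _) (fun n => hindep n _)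
      (hint.const_mul (δ * ε ^ 2)⁻¹).lintegral_lt_top.ne ?_
    filter_upwards [hstep] with ω hω
    refine ENNReal.tsum_le_of_sum_range_le fun N => ?_
    rw [← ENNReal.ofReal_sum_of_nonneg fun _ _ => sq_nonneg _]
    refine ENNReal.ofReal_le_ofReal ?_
    rw [← div_eq_inv_mul, le_div_iff₀' (by positivity), Finset.mul_sum]
    refine le_trans (Finset.sum_le_sum fun n _ => ?_) (haugazeau_sum_le (x := fun n => x n ω)
      hZne (fun n => (hω n).1) (fun n => hxsucc n ω) hz N)
    rw [← hp]
    exact (hω n).2 _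
  have hconv : ∀ᵐ ω ∂μ, Tendsto (fun n => x n ω) atTop (𝓝 (q ω)) := by
    filter_upwards [hnorm_le, hresid] with ω hle hres
    refine (hq ω).tendsto_of_weak_cluster_mem hZconvex hle fun φ w hφ hw => hmemZ.2 ?_
    filter_upwards [hres] with c hc
    refine hTdemi c _ w hw ?_
    have hsq := (ENNReal.tendsto_toReal ENNReal.zero_ne_top).comp (hc.comp hφ)
    rw [tendsto_zero_iff_norm_tendsto_zero]
    simpa [Function.comp_def, ENNReal.toReal_ofReal, Real.sqrt_sq, norm_sub_rev] using hsq.sqrt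
  refine ⟨hconv, ?_⟩
  have hqmeas : AEMeasurable q μ := aemeasurable_of_tendsto_metrizable_ae atTop hxmeas hconv
  rw [← integral_zero Ω ℝ (μ := μ)]
  refine tendsto_integral_of_dominated_convergence (fun ω => 4 * ‖x 0 ω - z‖ ^ 2)
    (fun n => ((hxmeas n).sub hqmeas).norm.pow_const 2 |>.aestronglyMeasurable)
    (hint.const_mul 4) (fun n => ?_) ?_
  · filter_upwards [hnorm_le] with ω hω
    have h1 := norm_sub_le_norm_sub_add_norm_sub (x n ω) (x 0 ω) (q ω)
    rw [norm_sub_rev (x n ω) (x 0 ω)] at h1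
    rw [Real.norm_of_nonneg (sq_nonneg _)]
    calc ‖x n ω - q ω‖ ^ 2 ≤ (2 * ‖x 0 ω - z‖) ^ 2 :=
          pow_le_pow_left₀ (norm_nonneg _) (by linarith [hω n, (hq ω).2 z hz]) 2
      _ = _ := by ring
  · filter_upwards [hconv] with ω hω
    simpa using (hω.sub_const (q ω)).norm.pow 2
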